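/- Let q be a prime power with q ≡ 3 (mod 4), let F be a finite field with q² elements, fix a primitive element ω of F, and let D₀ = C₀⁽⁴⁾ ∪ C₁⁽⁴⁾ and D₂ = C₂⁽⁴⁾ ∪ C₃⁽⁴⁾. In G = ℤ/2ℤ × F, set B₀ = ({0} × D₀) ∪ ({1} × (F ∖ D₀)) and B₁ = ({0} × D₂) ∪ ({1} × D₂). Then for every (ε, x) ∈ G, the quantity N(B₀,B₀;(ε,x)) + N(B₁,B₁;(ε,x)) equals: 2q² − 1 if (ε,x) = (0,0); q² − 2 if ε = 0 and x ≠ 0; q² + 1 if ε = 1 and x ∈ D₀; q² − 3 if ε = 1 and x ∈ D₂; and q² − 1 if ε = 1 and x = 0. -/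

import Mathlib

/-- The number of pairs `(u, v) ∈ A × B` with `u - v = g`. -/
noncomputable def diffCount {G : Type*} [AddGroup G] (A B : Set G) (g : G) : ℕ :=
  Set.ncard {p : G × G | p.1 ∈ A ∧ p.2 ∈ B ∧ p.1 - p.2 = g}

/-- The `N`-th cyclotomic class `C_i^{(N)} = {ω^(i+Nk) : k ∈ ℤ}`. -/
def cyc {F : Type*} [Field F] (ω : F) (N : ℕ) (i : ℤ) : Set F :=
  {x : F | ∃ k : ℤ, x = ω ^ (i + (N : ℤ) * k)}

section Autocorrelation

open Finset

variable {F : Type*} [Field F]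

theorem map_sq_pow_mul {s : F → ℤ} {ω : F} (hs : ∀ y, s (ω ^ 2 * y) = -s y) (m : ℕ) (y : F) :
    s (ω ^ (2 * m) * y) = (-1) ^ m * s y := by
  induction m with
  | zero => simp
  | succ m ih => rw [mul_add, mul_one, add_comm, pow_add, mul_assoc, hs, ih]; ring

variable [Fintype F]

/-- The autocorrelation of an integer-valued function on a finite field. -/
def autocorr (s : F → ℤ) (x : F) : ℤ := ∑ y, s (y + x) * s y

theorem sum_autocorr (s : F → ℤ) : ∑ x, autocorr s x = (∑ y, s y) ^ 2 := by
  simp only [autocorr]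
  rw [sum_comm, sq, sum_mul]
  refine sum_congr rfl fun y _ => ?_
  rw [← sum_mul, mul_comm]
  congr 1
  exact Equiv.sum_comp (Equiv.addLeft y) s

theorem autocorr_mul {c : F} (hc : c ≠ 0) (s : F → ℤ) (x : F) :
    autocorr s (c * x) = autocorr (fun y => s (c * y)) x := by
  simp only [autocorr]
  rw [← Equiv.sum_comp (Equiv.mulLeft₀ c hc)]
  simp [mul_add]

theorem autocorr_ringEquiv (f : F ≃+* F) (s : F → ℤ) (x : F) :
    autocorr s (f x) = autocorr (fun y => s (f y)) x := by
  simp only [autocorr]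
  rw [← Equiv.sum_comp f.toEquiv]
  simp

theorem sum_eq_zero_of_map_sq_mul {s : F → ℤ} {ω : F} (hω : ω ≠ 0)
    (hs : ∀ y, s (ω ^ 2 * y) = -s y) : ∑ y, s y = 0 := by
  have h := Equiv.sum_comp (Equiv.mulLeft₀ (ω ^ 2) (pow_ne_zero 2 hω)) s
  simp only [Equiv.mulLeft₀_apply, hs, sum_neg_distrib] at h
  omega

theorem autocorr_sq_pow_mul {s : F → ℤ} {ω : F} (hω : ω ≠ 0)
    (hs : ∀ y, s (ω ^ 2 * y) = -s y) (m : ℕ) (x : F) :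
    autocorr s (ω ^ (2 * m) * x) = autocorr s x := by
  rw [autocorr_mul (pow_ne_zero _ hω)]
  refine sum_congr rfl fun y _ => ?_
  simp only [map_sq_pow_mul hs]
  rw [mul_mul_mul_comm, ← mul_pow]
  simp

/-- A function that changes sign under multiplication by `ω ^ 2`, and on which multiplication by
`ω` acts as an odd power map that is a field automorphism, has autocorrelation constant on
nonzero elements. -/
theorem autocorr_pow {s : F → ℤ} {ω : F} (hω : ω ≠ 0) (hs : ∀ y, s (ω ^ 2 * y) = -s y)
    {q : ℕ} (hq : q % 2 = 1) (f : F ≃+* F) (hf : ∀ y, f y = y ^ q)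
    (hsf : ∀ y, s (y ^ q) = s (ω * y)) (k : ℕ) :
    autocorr s (ω ^ k) = autocorr s 1 := by
  induction k with
  | zero => simp
  | succ k ih =>
    rw [pow_succ', autocorr_mul hω, ← ih]
    simp only [← hsf, ← hf]
    rw [← autocorr_ringEquiv, hf, ← pow_mul]
    have : k * q = 2 * (k * (q / 2)) + k := by
      conv_lhs => rw [← Nat.div_add_mod q 2, hq]
      ring
    rw [this, pow_add, autocorr_sq_pow_mul hω hs]

theorem sum_sq_of_eq_one_or_neg_one {s : F → ℤ} (h0 : s 0 = 0)
    (h1 : ∀ x ≠ 0, s x = 1 ∨ s x = -1) : ∑ y, s y * s y = Fintype.card F - 1 := by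
  classical
  have h : ∀ y, s y * s y = 1 - if y = 0 then 1 else 0 := fun y => by
    by_cases hy : y = 0
    · simp [hy, h0]
    · rcases h1 y hy with h | h <;> simp [hy, h]
  simp [h, sum_sub_distrib]

theorem autocorr_zero {s : F → ℤ} (h0 : s 0 = 0) (h1 : ∀ x ≠ 0, s x = 1 ∨ s x = -1) :
    autocorr s 0 = Fintype.card F - 1 := by
  simp [autocorr, sum_sq_of_eq_one_or_neg_one h0 h1]

theorem autocorr_eq_neg_one {s : F → ℤ} (h0 : s 0 = 0) (h1 : ∀ x ≠ 0, s x = 1 ∨ s x = -1)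
    (hsum : ∑ y, s y = 0) {c : ℤ} (hc : ∀ x ≠ 0, autocorr s x = c) {x : F} (hx : x ≠ 0) :
    autocorr s x = -1 := by
  classical
  have h := sum_autocorr s
  rw [hsum, ← add_sum_erase _ _ (mem_univ (0 : F)), autocorr_zero h0 h1,
    sum_congr rfl fun y hy => hc y (ne_of_mem_erase hy)] at h
  have hcard : 1 < Fintype.card F := Fintype.one_lt_card
  simp only [sum_const, card_erase_of_mem (mem_univ (0 : F)), card_univ, nsmul_eq_mul] at h
  push_cast [hcard.le] at h
  rw [hc x hx]
  have h' : ((Fintype.card F : ℤ) - 1) * (c + 1) = 0 := by linarith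
  rcases mul_eq_zero.1 h' with h | h <;> omega

end Autocorrelation

section Primitive

open Finset

variable {F : Type*} [Field F] {ω : F}

/-- The sign function that is `1` on `C₀ ∪ C₁` and `-1` on `C₂ ∪ C₃`. -/
noncomputable def quarticSign (ω : F) (x : F) : ℤ :=
  (cyc ω 4 0 ∪ cyc ω 4 1).indicator 1 x - (cyc ω 4 2 ∪ cyc ω 4 3).indicator 1 x

theorem pow_mem_cyc_iff (hω : ω ≠ 0) {N : ℕ} (hN : N ∣ orderOf ω) (k : ℕ) (i : ℤ) :
    ω ^ k ∈ cyc ω N i ↔ (N : ℤ) ∣ k - i := by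
  constructor
  · rintro ⟨m, hm⟩
    have h : (Units.mk0 ω hω) ^ ((k : ℤ) - (i + N * m)) = 1 := by
      ext
      push_cast
      rw [Units.val_mk0, zpow_sub₀ hω, ← hm, zpow_natCast]
      exact div_self (pow_ne_zero _ hω)
    rw [← orderOf_dvd_iff_zpow_eq_one, ← orderOf_units, Units.val_mk0] at h
    have h' := (Int.natCast_dvd_natCast.2 hN).trans h
    have : (k : ℤ) - i = (k - (i + N * m)) + N * m := by ring
    rw [this]
    exact dvd_add h' (dvd_mul_right _ _)
  · rintro ⟨m, hm⟩
    refine ⟨m, ?_⟩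
    rw [← hm, ← zpow_natCast]
    ring_nf

theorem zero_notMem_cyc (hω : ω ≠ 0) (N : ℕ) (i : ℤ) : (0 : F) ∉ cyc ω N i := by
  rintro ⟨m, hm⟩
  exact zpow_ne_zero _ hω hm.symm

theorem pow_mem_cyc_zero_union_one_iff (hω : ω ≠ 0) (h4 : 4 ∣ orderOf ω) (k : ℕ) :
    ω ^ k ∈ cyc ω 4 0 ∪ cyc ω 4 1 ↔ k % 4 < 2 := by
  rw [Set.mem_union, pow_mem_cyc_iff hω h4, pow_mem_cyc_iff hω h4]
  omega

theorem pow_mem_cyc_two_union_three_iff (hω : ω ≠ 0) (h4 : 4 ∣ orderOf ω) (k : ℕ) :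
    ω ^ k ∈ cyc ω 4 2 ∪ cyc ω 4 3 ↔ ¬ k % 4 < 2 := by
  rw [Set.mem_union, pow_mem_cyc_iff hω h4, pow_mem_cyc_iff hω h4]
  omega

theorem quarticSign_pow (hω : ω ≠ 0) (h4 : 4 ∣ orderOf ω) (k : ℕ) :
    quarticSign ω (ω ^ k) = if k % 4 < 2 then 1 else -1 := by
  classical
  simp only [quarticSign, Set.indicator_apply, pow_mem_cyc_zero_union_one_iff hω h4,
    pow_mem_cyc_two_union_three_iff hω h4]
  split_ifs <;> simp

theorem quarticSign_zero (hω : ω ≠ 0) : quarticSign ω 0 = 0 := by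
  simp [quarticSign, zero_notMem_cyc hω]

theorem ne_zero_of_forall_eq_pow [Fintype F] (hcard : 2 < Fintype.card F)
    (h : ∀ x : F, x ≠ 0 → ∃ k : ℕ, x = ω ^ k) : ω ≠ 0 := by
  classical
  rintro rfl
  have hsub : (univ : Finset F) ⊆ {0, 1} := fun x _ => by
    by_cases hx : x = 0
    · simp [hx]
    · obtain ⟨k, rfl⟩ := h x hx
      rcases k with _ | k <;> simp
  have := (card_le_card hsub).trans card_le_two
  rw [card_univ] at this
  omega

theorem orderOf_of_forall_eq_pow [Fintype F] (hω : ω ≠ 0)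
    (h : ∀ x : F, x ≠ 0 → ∃ k : ℕ, x = ω ^ k) : orderOf ω = Fintype.card F - 1 := by
  classical
  have hz : ∀ x : Fˣ, x ∈ Subgroup.zpowers (Units.mk0 ω hω) := fun x => by
    obtain ⟨k, hk⟩ := h x x.ne_zero
    exact ⟨k, by ext; simp [hk]⟩
  rw [← Fintype.card_units, ← Nat.card_eq_fintype_card, ← orderOf_eq_card_of_forall_mem_zpowers hz,
    ← orderOf_units, Units.val_mk0]

/-- If `q ^ 2 = |F|`, the map `x ↦ x ^ q` is a field automorphism. -/
theorem exists_ringEquiv_pow [Fintype F] {q : ℕ} (hq : IsPrimePow q)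
    (hF : Fintype.card F = q ^ 2) : ∃ f : F ≃+* F, ∀ x, f x = x ^ q := by
  obtain ⟨p, n, hp, -, rfl⟩ := hq
  have hp' : p.Prime := hp.nat_prime
  obtain ⟨r, hr⟩ := CharP.exists F
  obtain ⟨m, hr', hm⟩ := FiniteField.card F r
  have hrp : r = p := by
    have : r ∣ (p ^ n) ^ 2 := by
      rw [← hF, hm]
      exact dvd_pow_self r m.ne_zero
    exact (Nat.prime_dvd_prime_iff_eq hr' hp').1
      (hr'.dvd_of_dvd_pow (hr'.dvd_of_dvd_pow this))
  subst hrp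
  have := Fact.mk hr'
  exact ⟨iterateFrobeniusEquiv F r n, fun x => by simp [iterateFrobenius_def]⟩

end Primitive

section DiffCount

open Finset

/-- `diffCount` as a sum of products of indicator functions. -/
theorem natCast_diffCount {G : Type*} [AddGroup G] [Fintype G] (A B : Set G) (g : G) :
    (diffCount A B g : ℤ) = ∑ y, A.indicator 1 (g + y) * B.indicator 1 y := by
  classical
  have h : {p : G × G | p.1 ∈ A ∧ p.2 ∈ B ∧ p.1 - p.2 = g} =
      (fun y => (g + y, y)) '' {y | g + y ∈ A ∧ y ∈ B} := by
    ext ⟨a, b⟩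
    simp only [Set.mem_ofPred_eq, Set.mem_image, Prod.mk.injEq]
    constructor
    · rintro ⟨ha, hb, rfl⟩
      exact ⟨b, by simpa using ⟨ha, hb⟩, by simp⟩
    · rintro ⟨y, ⟨h1, h2⟩, rfl, rfl⟩
      exact ⟨h1, h2, by simp⟩
  rw [diffCount, h, Set.ncard_image_of_injective _ fun a b hab => (Prod.mk.inj hab).2,
    Set.ncard_eq_toFinset_card', Set.toFinset_ofPred, card_filter]
  push_cast
  refine sum_congr rfl fun y _ => ?_
  by_cases h1 : g + y ∈ A <;> by_cases h2 : y ∈ B <;> simp [h1, h2]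

theorem indicator_zmodTwo_union {F : Type*} (A B : Set F) (y : F) :
    (({0} : Set (ZMod 2)) ×ˢ A ∪ ({1} : Set (ZMod 2)) ×ˢ B).indicator (1 : ZMod 2 × F → ℤ) (0, y)
        = A.indicator 1 y ∧
      (({0} : Set (ZMod 2)) ×ˢ A ∪ ({1} : Set (ZMod 2)) ×ˢ B).indicator (1 : ZMod 2 × F → ℤ) (1, y)
        = B.indicator 1 y := by
  classical
  simp [Set.indicator_apply]

theorem indicator_compl_eq_one_sub {F : Type*} (A : Set F) (y : F) :
    Aᶜ.indicator (1 : F → ℤ) y = 1 - A.indicator 1 y := by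
  classical
  by_cases h : y ∈ A <;> simp [h]

variable {F : Type*} [Field F] [Fintype F]

theorem natCast_diffCount_zero (A B : Set F) (x : F) :
    (diffCount (({0} : Set (ZMod 2)) ×ˢ A ∪ ({1} : Set (ZMod 2)) ×ˢ B)
        (({0} : Set (ZMod 2)) ×ˢ A ∪ ({1} : Set (ZMod 2)) ×ˢ B) (0, x) : ℤ) =
      ∑ y, (A.indicator 1 (x + y) * A.indicator 1 y + B.indicator 1 (x + y) * B.indicator 1 y) := by
  rw [natCast_diffCount, Fintype.sum_prod_type, sum_add_distrib]
  refine (Fin.sum_univ_two _).trans ?_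
  congr 1 <;> refine sum_congr rfl fun y _ => ?_
  · have h : ((0 : ZMod 2), x) + ((0 : ZMod 2), y) = (0, x + y) :=
      Prod.ext rfl rfl
    change Set.indicator _ _ (((0 : ZMod 2), x) + ((0 : ZMod 2), y)) *
      Set.indicator _ _ ((0 : ZMod 2), y) = _
    rw [h, (indicator_zmodTwo_union A B y).1, (indicator_zmodTwo_union A B _).1]
  · have h : ((0 : ZMod 2), x) + ((1 : ZMod 2), y) = (1, x + y) :=
      Prod.ext rfl rfl
    change Set.indicator _ _ (((0 : ZMod 2), x) + ((1 : ZMod 2), y)) *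
      Set.indicator _ _ ((1 : ZMod 2), y) = _
    rw [h, (indicator_zmodTwo_union A B y).2, (indicator_zmodTwo_union A B _).2]

theorem natCast_diffCount_one (A B : Set F) (x : F) :
    (diffCount (({0} : Set (ZMod 2)) ×ˢ A ∪ ({1} : Set (ZMod 2)) ×ˢ B)
        (({0} : Set (ZMod 2)) ×ˢ A ∪ ({1} : Set (ZMod 2)) ×ˢ B) (1, x) : ℤ) =
      ∑ y, (B.indicator 1 (x + y) * A.indicator 1 y + A.indicator 1 (x + y) * B.indicator 1 y) := by
  rw [natCast_diffCount, Fintype.sum_prod_type, sum_add_distrib]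
  refine (Fin.sum_univ_two _).trans ?_
  congr 1 <;> refine sum_congr rfl fun y _ => ?_
  · have h : ((1 : ZMod 2), x) + ((0 : ZMod 2), y) = (1, x + y) :=
      Prod.ext rfl rfl
    change Set.indicator _ _ (((1 : ZMod 2), x) + ((0 : ZMod 2), y)) *
      Set.indicator _ _ ((0 : ZMod 2), y) = _
    rw [h, (indicator_zmodTwo_union A B y).1, (indicator_zmodTwo_union A B _).2]
  · have h : ((1 : ZMod 2), x) + ((1 : ZMod 2), y) = (0, x + y) :=
      Prod.ext rfl rfl
    change Set.indicator _ _ (((1 : ZMod 2), x) + ((1 : ZMod 2), y)) *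
      Set.indicator _ _ ((1 : ZMod 2), y) = _
    rw [h, (indicator_zmodTwo_union A B y).2, (indicator_zmodTwo_union A B _).1]

theorem sum_map_add_mul_sq {s : F → ℤ} (h0 : s 0 = 0) (h1 : ∀ x ≠ 0, s x = 1 ∨ s x = -1)
    (hsum : ∑ y, s y = 0) (x : F) : ∑ y, s (x + y) * (s y * s y) = -s x := by
  classical
  have h : ∀ y, s (x + y) * (s y * s y) = s (x + y) - if y = 0 then s x else 0 := fun y => by
    by_cases hy : y = 0
    · simp [hy, h0]
    · rcases h1 y hy with h | h <;> simp [hy, h]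
  have hx : ∑ y, s (x + y) = 0 := (Equiv.sum_comp (Equiv.addLeft x) s).trans hsum
  simp [h, sum_sub_distrib, hx]

theorem sum_sq_add_mul_map {s : F → ℤ} (h0 : s 0 = 0) (h1 : ∀ x ≠ 0, s x = 1 ∨ s x = -1)
    (hsum : ∑ y, s y = 0) (hneg : ∀ y, s (-y) = s y) (x : F) :
    ∑ y, s (x + y) * s (x + y) * s y = -s x := by
  rw [← hneg, ← sum_map_add_mul_sq h0 h1 hsum]
  conv_rhs => rw [← Equiv.sum_comp (Equiv.addLeft x)]
  refine sum_congr rfl fun y _ => ?_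
  simp [mul_comm]

theorem sum_sq_add_mul_sq {s : F → ℤ} (h0 : s 0 = 0) (h1 : ∀ x ≠ 0, s x = 1 ∨ s x = -1)
    {x : F} (hx : x ≠ 0) :
    ∑ y, s (x + y) * s (x + y) * (s y * s y) = Fintype.card F - 2 := by
  classical
  have hs : ∀ y ≠ 0, s y * s y = 1 := fun y hy => by
    rcases h1 y hy with h | h <;> simp [h]
  have h : ∀ y, s (x + y) * s (x + y) * (s y * s y) =
      1 - (if y = 0 then 1 else 0) - if y = -x then 1 else 0 := fun y => by
    by_cases hy : y = 0
    · simp [hy, h0, hx, eq_comm]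
    · by_cases hxy : y = -x
      · simp [hxy, h0, hx]
      · have : x + y ≠ 0 := fun h => hxy (eq_neg_of_add_eq_zero_right h)
        simp [hy, hxy, hs y hy, hs _ this]
  simp only [h, sum_sub_distrib, sum_ite_eq', mem_univ, if_true, sum_const, card_univ]
  simp
  ring

theorem natCast_diffCount_zero_add {s : F → ℤ} {D E : Set F}
    (hD : ∀ y, 2 * D.indicator 1 y = s y * s y + s y)
    (hE : ∀ y, 2 * E.indicator 1 y = s y * s y - s y)
    (h0 : s 0 = 0) (h1 : ∀ x ≠ 0, s x = 1 ∨ s x = -1)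
    (hsum : ∑ y, s y = 0) (x : F) :
    (diffCount (({0} : Set (ZMod 2)) ×ˢ D ∪ ({1} : Set (ZMod 2)) ×ˢ Dᶜ)
        (({0} : Set (ZMod 2)) ×ˢ D ∪ ({1} : Set (ZMod 2)) ×ˢ Dᶜ) (0, x) +
      diffCount (({0} : Set (ZMod 2)) ×ˢ E ∪ ({1} : Set (ZMod 2)) ×ˢ E)
        (({0} : Set (ZMod 2)) ×ˢ E ∪ ({1} : Set (ZMod 2)) ×ˢ E) (0, x) : ℤ) =
      ∑ y, s (x + y) * s (x + y) * (s y * s y) + autocorr s x + 1 := by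
  have hx : ∑ y, s (x + y) = 0 := (Equiv.sum_comp (Equiv.addLeft x) s).trans hsum
  have hu := sum_sq_of_eq_one_or_neg_one h0 h1
  have hux : ∑ y, s (x + y) * s (x + y) = Fintype.card F - 1 :=
    (Equiv.sum_comp (Equiv.addLeft x) fun y => s y * s y).trans hu
  have hn : ∑ _y : F, (1 : ℤ) = Fintype.card F := by simp
  rw [natCast_diffCount_zero, natCast_diffCount_zero, ← sum_add_distrib]
  have key : ∀ y, 2 * (D.indicator 1 (x + y) * D.indicator 1 y +
        Dᶜ.indicator 1 (x + y) * Dᶜ.indicator 1 y +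
        (E.indicator 1 (x + y) * E.indicator 1 y + E.indicator 1 (x + y) * E.indicator 1 y)) =
      2 * (s (x + y) * s (x + y) * (s y * s y)) + 2 * (s (y + x) * s y) + 2 * 1
        - s (x + y) * s (x + y) - s y * s y - s (x + y) - s y := fun y => by
    rw [indicator_compl_eq_one_sub, indicator_compl_eq_one_sub, add_comm y x]
    linear_combination (2 * D.indicator 1 y - 1) * hD (x + y) +
      (s (x + y) * s (x + y) + s (x + y) - 1) * hD y +
      2 * E.indicator 1 y * hE (x + y) + (s (x + y) * s (x + y) - s (x + y)) * hE y
  have := Finset.sum_congr rfl fun y (_ : y ∈ univ) => key y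
  simp only [sum_add_distrib, sum_sub_distrib, ← mul_sum] at this ⊢
  rw [hx, hu, hux, hn, hsum] at this
  simp only [autocorr]
  linarith

theorem natCast_diffCount_one_add {s : F → ℤ} {D E : Set F}
    (hD : ∀ y, 2 * D.indicator 1 y = s y * s y + s y)
    (hE : ∀ y, 2 * E.indicator 1 y = s y * s y - s y)
    (h0 : s 0 = 0) (h1 : ∀ x ≠ 0, s x = 1 ∨ s x = -1)
    (hsum : ∑ y, s y = 0) (hneg : ∀ y, s (-y) = s y) (x : F) :
    (diffCount (({0} : Set (ZMod 2)) ×ˢ D ∪ ({1} : Set (ZMod 2)) ×ˢ Dᶜ)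
        (({0} : Set (ZMod 2)) ×ˢ D ∪ ({1} : Set (ZMod 2)) ×ˢ Dᶜ) (1, x) +
      diffCount (({0} : Set (ZMod 2)) ×ˢ E ∪ ({1} : Set (ZMod 2)) ×ˢ E)
        (({0} : Set (ZMod 2)) ×ˢ E ∪ ({1} : Set (ZMod 2)) ×ˢ E) (1, x) : ℤ) =
      Fintype.card F - 1 + 2 * s x := by
  have hx : ∑ y, s (x + y) = 0 := (Equiv.sum_comp (Equiv.addLeft x) s).trans hsum
  have hu := sum_sq_of_eq_one_or_neg_one h0 h1
  have hux : ∑ y, s (x + y) * s (x + y) = Fintype.card F - 1 :=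
    (Equiv.sum_comp (Equiv.addLeft x) fun y => s y * s y).trans hu
  have hsu := sum_map_add_mul_sq h0 h1 hsum x
  have hus := sum_sq_add_mul_map h0 h1 hsum hneg x
  rw [natCast_diffCount_one, natCast_diffCount_one, ← sum_add_distrib]
  have key : ∀ y, 2 * (Dᶜ.indicator 1 (x + y) * D.indicator 1 y +
        D.indicator 1 (x + y) * Dᶜ.indicator 1 y +
        (E.indicator 1 (x + y) * E.indicator 1 y + E.indicator 1 (x + y) * E.indicator 1 y)) =
      s (x + y) * s (x + y) + s y * s y + s (x + y) + s y
        - 2 * (s (x + y) * (s y * s y)) - 2 * (s (x + y) * s (x + y) * s y) := fun y => by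
    rw [indicator_compl_eq_one_sub, indicator_compl_eq_one_sub]
    linear_combination (1 - 2 * D.indicator 1 y) * hD (x + y) +
      (1 - s (x + y) * s (x + y) - s (x + y)) * hD y +
      2 * E.indicator 1 y * hE (x + y) + (s (x + y) * s (x + y) - s (x + y)) * hE y
  have := Finset.sum_congr rfl fun y (_ : y ∈ univ) => key y
  simp only [sum_add_distrib, sum_sub_distrib, ← mul_sum] at this ⊢
  rw [hx, hu, hux, hsum, hsu, hus] at this
  linarith

end DiffCount

theorem stmt_4 (q : ℕ) (hq : IsPrimePow q) (h4 : q % 4 = 3)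
    (F : Type*) [Field F] [Fintype F] (hF : Fintype.card F = q ^ 2)
    (ω : F) (hω : ∀ x : F, x ≠ 0 → ∃ k : ℕ, x = ω ^ k) :
    let D₀ : Set F := cyc ω 4 0 ∪ cyc ω 4 1
    let D₂ : Set F := cyc ω 4 2 ∪ cyc ω 4 3
    let B₀ : Set (ZMod 2 × F) := ({0} : Set (ZMod 2)) ×ˢ D₀ ∪ ({1} : Set (ZMod 2)) ×ˢ D₀ᶜ
    let B₁ : Set (ZMod 2 × F) := ({0} : Set (ZMod 2)) ×ˢ D₂ ∪ ({1} : Set (ZMod 2)) ×ˢ D₂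
    ∀ (ε : ZMod 2) (x : F),
      (ε = 0 ∧ x = 0 → diffCount B₀ B₀ (ε, x) + diffCount B₁ B₁ (ε, x) = 2 * q ^ 2 - 1) ∧
      (ε = 0 ∧ x ≠ 0 → diffCount B₀ B₀ (ε, x) + diffCount B₁ B₁ (ε, x) = q ^ 2 - 2) ∧
      (ε = 1 ∧ x ∈ D₀ → diffCount B₀ B₀ (ε, x) + diffCount B₁ B₁ (ε, x) = q ^ 2 + 1) ∧
      (ε = 1 ∧ x ∈ D₂ → diffCount B₀ B₀ (ε, x) + diffCount B₁ B₁ (ε, x) = q ^ 2 - 3) ∧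
      (ε = 1 ∧ x = 0 → diffCount B₀ B₀ (ε, x) + diffCount B₁ B₁ (ε, x) = q ^ 2 - 1) := by
  intro D₀ D₂ B₀ B₁ ε x
  classical
  have hq2 : q ^ 2 = 8 * (2 * (q / 4) ^ 2 + 3 * (q / 4) + 1) + 1 := by
    conv_lhs => rw [← Nat.div_add_mod q 4, h4]
    ring
  set m := 2 * (q / 4) ^ 2 + 3 * (q / 4) + 1
  have hm0 : 0 < m := by omega
  have hω0 : ω ≠ 0 := ne_zero_of_forall_eq_pow (by omega) hω
  have hord : orderOf ω = 8 * m := by rw [orderOf_of_forall_eq_pow hω0 hω]; omega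
  have h4ord : 4 ∣ orderOf ω := by omega
  set s := quarticSign ω
  have hs0 : s 0 = 0 := quarticSign_zero hω0
  have hspow : ∀ k : ℕ, s (ω ^ k) = if k % 4 < 2 then 1 else -1 := quarticSign_pow hω0 h4ord
  have hs1 : ∀ x ≠ 0, s x = 1 ∨ s x = -1 := fun x hx => by
    obtain ⟨k, rfl⟩ := hω x hx
    rw [hspow]
    split_ifs <;> simp
  have hs2 : ∀ y, s (ω ^ 2 * y) = -s y := fun y => by
    by_cases hy : y = 0
    · simp [hy, hs0]
    · obtain ⟨k, rfl⟩ := hω y hy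
      rw [← pow_add, hspow, hspow]
      split_ifs <;> omega
  have hsq : ∀ y, s (y ^ q) = s (ω * y) := fun y => by
    by_cases hy : y = 0
    · simp [hy, show q ≠ 0 by omega]
    · obtain ⟨k, rfl⟩ := hω y hy
      rw [← pow_mul, ← pow_succ', hspow, hspow, Nat.mul_mod, h4, Nat.add_mod]
      have : k % 4 < 4 := Nat.mod_lt _ (by norm_num)
      interval_cases k % 4 <;> simp
  have hneg1 : (-1 : F) = ω ^ (2 * (2 * m)) := by
    have h1 : (ω ^ (2 * (2 * m))) ^ 2 = 1 := by
      rw [← pow_mul, show 2 * (2 * m) * 2 = orderOf ω by omega, pow_orderOf_eq_one]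
    rcases sq_eq_one_iff.1 h1 with h | h
    · have := Nat.le_of_dvd (by omega) (orderOf_dvd_of_pow_eq_one h)
      omega
    · exact h.symm
  have hsneg : ∀ y, s (-y) = s y := fun y => by
    rw [← neg_one_mul, hneg1, map_sq_pow_mul hs2]
    simp
  have hsum : ∑ y, s y = 0 := sum_eq_zero_of_map_sq_mul hω0 hs2
  obtain ⟨f, hf⟩ := exists_ringEquiv_pow hq hF
  have hA : ∀ x ≠ 0, autocorr s x = -1 := fun x hx =>
    autocorr_eq_neg_one hs0 hs1 hsum (c := autocorr s 1) (fun y hy => by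
      obtain ⟨k, rfl⟩ := hω y hy
      exact autocorr_pow hω0 hs2 (by omega) f hf hsq k) hx
  have hD₀ : ∀ k : ℕ, ω ^ k ∈ D₀ ↔ k % 4 < 2 := pow_mem_cyc_zero_union_one_iff hω0 h4ord
  have hD₂ : ∀ k : ℕ, ω ^ k ∈ D₂ ↔ ¬ k % 4 < 2 := pow_mem_cyc_two_union_three_iff hω0 h4ord
  have hD₀0 : (0 : F) ∉ D₀ := by simp [D₀, zero_notMem_cyc hω0]
  have hD₂0 : (0 : F) ∉ D₂ := by simp [D₂, zero_notMem_cyc hω0]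
  have hI : ∀ y, 2 * D₀.indicator 1 y = s y * s y + s y := fun y => by
    by_cases hy : y = 0
    · simp [hy, hs0, hD₀0]
    · obtain ⟨k, rfl⟩ := hω y hy
      by_cases h : k % 4 < 2 <;> simp [hD₀, hspow, h]
  have hJ : ∀ y, 2 * D₂.indicator 1 y = s y * s y - s y := fun y => by
    by_cases hy : y = 0
    · simp [hy, hs0, hD₂0]
    · obtain ⟨k, rfl⟩ := hω y hy
      by_cases h : k % 4 < 2 <;> simp only [Set.indicator_apply, hD₂, hspow, h] <;> simp
  have hzero : (diffCount B₀ B₀ (0, x) + diffCount B₁ B₁ (0, x) : ℤ) = _ :=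
    natCast_diffCount_zero_add hI hJ hs0 hs1 hsum x
  have hone : (diffCount B₀ B₀ (1, x) + diffCount B₁ B₁ (1, x) : ℤ) = _ :=
    natCast_diffCount_one_add hI hJ hs0 hs1 hsum hsneg x
  rw [hF] at hone
  refine ⟨?_, ?_, ?_, ?_, ?_⟩
  · rintro ⟨rfl, rfl⟩
    have hsq : ∀ y, s y * s y * (s y * s y) = s y * s y := fun y => by
      by_cases hy : y = 0
      · simp [hy, hs0]
      · rcases hs1 y hy with h | h <;> simp [h]
    simp only [zero_add, hsq] at hzero
    rw [sum_sq_of_eq_one_or_neg_one hs0 hs1, autocorr_zero hs0 hs1, hF] at hzero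
    omega
  · rintro ⟨rfl, hx⟩
    rw [sum_sq_add_mul_sq hs0 hs1 hx, hA x hx, hF] at hzero
    omega
  · rintro ⟨rfl, hx⟩
    have hx0 : x ≠ 0 := fun h => hD₀0 (h ▸ hx)
    obtain ⟨k, rfl⟩ := hω x hx0
    rw [hspow, if_pos ((hD₀ k).1 hx)] at hone
    omega
  · rintro ⟨rfl, hx⟩
    have hx0 : x ≠ 0 := fun h => hD₂0 (h ▸ hx)
    obtain ⟨k, rfl⟩ := hω x hx0
    rw [hspow, if_neg ((hD₂ k).1 hx)] at hone
    omega
  · rintro ⟨rfl, rfl⟩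
    rw [hs0] at hone
    omega
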